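/- Let α = (α0,α1,α2,α3,α4) ∈ ℂ^5 satisfy α0+α1+2α2+α3+α4 = 1, let J ⊆ ℝ∖{0,1} be an open interval, and let q,p : J → ℂ be differentiable with p(t) ≠ 0 for all t ∈ J, satisfying q'(t) = ∂G/∂p(q(t),p(t),t;α) and p'(t) = −∂G/∂q(q(t),p(t),t;α). Let σ(s) = s/(s−1) (an involution of ℝ∖{1} preserving ℝ∖{0,1}), let J' = σ(J) = {σ(t) : t ∈ J}, and define on J' the functions q̃(s) = (1−σ(s))·(q(σ(s)) + (α0−α4)/p(σ(s)) + σ(s)/p(σ(s))²) and p̃(s) = p(σ(s))/(1−σ(s)), and put α̃ = (α4, α1, α2, α3, α0). Then q̃'(s) = ∂G/∂p(q̃(s),p̃(s),s;α̃) and p̃'(s) = −∂G/∂q(q̃(s),p̃(s),s;α̃) for all s ∈ J'; that is, w0 is a Bäcklund transformation of the G-system. -/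

import Mathlib

/-- The polynomial Hamiltonian `G(q,p,t;α)` equivalent to the Painlevé VI
Hamiltonian, characterized by holomorphy conditions. -/
noncomputable def hamG (a0 a1 a2 a3 a4 q p t : ℂ) : ℂ :=
  -(q^3 * p^4) / (t * (t - 1))
  - (a0 + a3 - 2*a4 - 1) * q^2 * p^3 / (t * (t - 1))
  - (t + 1) * q^2 * p^2 / (t * (t - 1))
  - (a1*a2 + a2^2 + 2*a4 - 2*a0*a4 - 2*a3*a4 + a4^2) * q * p^2 / (t * (t - 1))
  - ((a3 - a4) * t + a0 - a4 - 1) * q * p / (t * (t - 1))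
  - q / (t - 1)
  + a4 * (a2 + a4) * (a1 + a2 + a4) * p / (t * (t - 1))

/-- The partial derivative `∂G/∂p`. -/
noncomputable def hamGp (a0 a1 a2 a3 a4 q p t : ℂ) : ℂ :=
  deriv (fun x => hamG a0 a1 a2 a3 a4 q x t) p

/-- The partial derivative `∂G/∂q`. -/
noncomputable def hamGq (a0 a1 a2 a3 a4 q p t : ℂ) : ℂ :=
  deriv (fun x => hamG a0 a1 a2 a3 a4 x p t) q

theorem hamGp_eq (a0 a1 a2 a3 a4 q p t : ℂ) : hamGp a0 a1 a2 a3 a4 q p t =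
    (-(q^3*(4*p^3)) - (a0+a3-2*a4-1)*q^2*(3*p^2) - (t+1)*q^2*(2*p)
      - (a1*a2+a2^2+2*a4-2*a0*a4-2*a3*a4+a4^2)*q*(2*p)
      - ((a3-a4)*t+a0-a4-1)*q + a4*(a2+a4)*(a1+a2+a4)) / (t*(t-1)) := by
  unfold hamGp hamG
  have h1 := hasDerivAt_id' p
  have h := ((((((((h1.pow 4).const_mul (q^3)).neg.div_const (t*(t-1))).sub
    (((h1.pow 3).const_mul ((a0+a3-2*a4-1)*q^2)).div_const (t*(t-1)))).sub
    (((h1.pow 2).const_mul ((t+1)*q^2)).div_const (t*(t-1)))).sub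
    (((h1.pow 2).const_mul
      ((a1*a2+a2^2+2*a4-2*a0*a4-2*a3*a4+a4^2)*q)).div_const (t*(t-1)))).sub
    ((h1.const_mul (((a3-a4)*t+a0-a4-1)*q)).div_const (t*(t-1)))).sub_const (q/(t-1))).add
    ((h1.const_mul (a4*(a2+a4)*(a1+a2+a4))).div_const (t*(t-1)))
  refine (HasDerivAt.deriv h).trans ?_
  simp
  ring

theorem hamGq_eq (a0 a1 a2 a3 a4 q p t : ℂ) : hamGq a0 a1 a2 a3 a4 q p t =
    (-(3*q^2*p^4) - (a0+a3-2*a4-1)*(2*q)*p^3 - (t+1)*(2*q)*p^2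
      - (a1*a2+a2^2+2*a4-2*a0*a4-2*a3*a4+a4^2)*p^2
      - ((a3-a4)*t+a0-a4-1)*p) / (t*(t-1)) - 1/(t-1) := by
  unfold hamGq hamG
  have h1 := hasDerivAt_id' q
  have h := (((((((((h1.pow 3).mul_const (p^4)).neg.div_const (t*(t-1))).sub
    ((((h1.pow 2).const_mul (a0+a3-2*a4-1)).mul_const (p^3)).div_const (t*(t-1)))).sub
    ((((h1.pow 2).const_mul (t+1)).mul_const (p^2)).div_const (t*(t-1)))).sub
    (((h1.const_mul
      (a1*a2+a2^2+2*a4-2*a0*a4-2*a3*a4+a4^2)).mul_const (p^2)).div_const (t*(t-1)))).sub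
    (((h1.const_mul ((a3-a4)*t+a0-a4-1)).mul_const p).div_const (t*(t-1)))).sub
    (h1.div_const (t-1)))).add_const (a4*(a2+a4)*(a1+a2+a4)*p/(t*(t-1)))
  refine (HasDerivAt.deriv h).trans ?_
  simp
  ring

set_option maxHeartbeats 2000000 in
/-- `w₀ : (q,p,t;α) ↦ ((1-t)(q + (α₀-α₄)/p + t/p²), p/(1-t), t/(t-1); α₄, α₁, α₂, α₃, α₀)`
is a Bäcklund transformation of the `G`-system. -/
theorem statement18 (a0 a1 a2 a3 a4 : ℂ)
    (hα : a0 + a1 + 2*a2 + a3 + a4 = 1)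
    (aa bb : ℝ) (hJ : Set.Ioo aa bb ⊆ {t : ℝ | t ≠ 0 ∧ t ≠ 1})
    (q p : ℝ → ℂ) (hp0 : ∀ t ∈ Set.Ioo aa bb, p t ≠ 0)
    (hq : ∀ t ∈ Set.Ioo aa bb,
      HasDerivAt q (hamGp a0 a1 a2 a3 a4 (q t) (p t) (t : ℂ)) t)
    (hp : ∀ t ∈ Set.Ioo aa bb,
      HasDerivAt p (-(hamGq a0 a1 a2 a3 a4 (q t) (p t) (t : ℂ))) t) :
    ∀ s ∈ (fun t : ℝ => t / (t - 1)) '' Set.Ioo aa bb,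
      HasDerivAt (fun s : ℝ =>
          ((1 - s / (s - 1) : ℝ) : ℂ) *
            (q (s / (s - 1)) + (a0 - a4) / p (s / (s - 1))
             + ((s / (s - 1) : ℝ) : ℂ) / (p (s / (s - 1)))^2))
        (hamGp a4 a1 a2 a3 a0
          (((1 - s / (s - 1) : ℝ) : ℂ) *
            (q (s / (s - 1)) + (a0 - a4) / p (s / (s - 1))
             + ((s / (s - 1) : ℝ) : ℂ) / (p (s / (s - 1)))^2))
          (p (s / (s - 1)) / ((1 - s / (s - 1) : ℝ) : ℂ)) (s : ℂ)) s ∧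
      HasDerivAt (fun s : ℝ => p (s / (s - 1)) / ((1 - s / (s - 1) : ℝ) : ℂ))
        (-(hamGq a4 a1 a2 a3 a0
          (((1 - s / (s - 1) : ℝ) : ℂ) *
            (q (s / (s - 1)) + (a0 - a4) / p (s / (s - 1))
             + ((s / (s - 1) : ℝ) : ℂ) / (p (s / (s - 1)))^2))
          (p (s / (s - 1)) / ((1 - s / (s - 1) : ℝ) : ℂ)) (s : ℂ))) s := by
  rintro s ⟨t, ht, rfl⟩
  obtain ⟨ht0, ht1⟩ := hJ ht
  have hs1 : t - 1 ≠ 0 := sub_ne_zero.2 ht1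
  have hs2 : t / (t - 1) - 1 = 1 / (t - 1) := by field_simp; ring
  have hs2' : t / (t - 1) - 1 ≠ 0 := by rw [hs2]; positivity
  have hinv : t / (t - 1) / (t / (t - 1) - 1) = t := by rw [hs2]; field_simp
  have hσ : HasDerivAt (fun s : ℝ => s / (s - 1)) (-(t - 1)^2) (t / (t - 1)) := by
    have := (hasDerivAt_id' (t / (t - 1))).div ((hasDerivAt_id' (t / (t - 1))).sub_const 1) hs2'
    refine this.congr_deriv ?_
    rw [hs2]; field_simp; ring
  have hpt := hp0 t ht
  have hqd := hq t ht
  have hpd := hp t ht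
  have hT0 : (t : ℂ) ≠ 0 := by exact_mod_cast ht0
  have hT1 : (t : ℂ) - 1 ≠ 0 := by exact_mod_cast hs1
  have hT1' : 1 - (t : ℂ) ≠ 0 := by rw [← neg_sub]; exact neg_ne_zero.2 hT1
  have hT1'' : ((1 - t : ℝ) : ℂ) ≠ 0 := by push_cast; exact hT1'
  have hS : (t : ℂ) / (t - 1) - 1 = 1 / ((t : ℂ) - 1) := by field_simp; ring
  have hid : HasDerivAt (fun x : ℝ => (x : ℂ)) 1 t := Complex.ofRealCLM.hasDerivAt
  have hom : HasDerivAt (fun x : ℝ => ((1 - x : ℝ) : ℂ)) (-1) t := by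
    have := hid.const_sub (1 : ℂ)
    simpa using this
  have hQ := hom.mul ((hqd.add ((hasDerivAt_const t (a0 - a4)).div hpd hpt)).add
    (hid.div (hpd.pow 2) (pow_ne_zero 2 hpt)))
  have hP := hpd.div hom hT1''
  have ha1 : a1 = 1 - a0 - 2*a2 - a3 - a4 := by linear_combination hα
  have e : t = (fun s : ℝ => s / (s - 1)) (t / (t - 1)) := hinv.symm
  have hQ2 := HasDerivAt.scomp_of_eq (t / (t - 1)) hQ hσ e
  have hP2 := HasDerivAt.scomp_of_eq (t / (t - 1)) hP hσ e
  constructor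
  · refine hQ2.congr_deriv ?_
    simp only [hinv, hamGp_eq, hamGq_eq]
    simp only [Pi.add_apply, Pi.div_apply, Pi.pow_apply, Complex.real_smul]
    push_cast
    rw [hS, ha1]
    generalize q t = Q at *
    generalize p t = P at *
    generalize (t : ℂ) = T at *
    rw [show (1 : ℂ) - T = -(T - 1) by ring]
    field_simp
    ring
  · refine hP2.congr_deriv ?_
    simp only [hinv, hamGp_eq, hamGq_eq]
    simp only [Complex.real_smul]
    push_cast
    rw [hS, ha1]
    generalize q t = Q at *
    generalize p t = P at *
    generalize (t : ℂ) = T at *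
    rw [show (1 : ℂ) - T = -(T - 1) by ring]
    field_simp
    ring
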